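/- Let 0 ≤ γ₁ ≤ γ₂ ≤ π and define γ : (0, 1) → [0, π] by: γ(s) = γ₁ if s ∈ (2·4^{−n}, 4·4^{−n}) for some integer n ≥ 1, γ(s) = γ₂ if s ∈ (4^{−n}, 2·4^{−n}) for some integer n ≥ 1, γ(4·4^{−n}) = π and γ(2·4^{−n}) = 0 for every integer n ≥ 1. Then for every b ∈ (0, 1), limsup_{ε→0⁺} (1/ε) ∫₀^{bε} cos(γ(t)) dt = b·((2/3)·cos(γ₁) + (1/3)·cos(γ₂)). -/

import Mathlib

open Real Set Filter MeasureTheory Topology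
open scoped Classical

/-- The contact angle of Example 2: `π` at the points `4·4^{−n}`, `0` at the points
`2·4^{−n}`, `γ₁` on each open interval `(2·4^{−n}, 4·4^{−n})`, and `γ₂` elsewhere
(in particular on each open interval `(4^{−n}, 2·4^{−n})`), for `n = 1, 2, 3, …`. -/
noncomputable def gammaEx2 (γ₁ γ₂ : ℝ) (s : ℝ) : ℝ :=
  if ∃ n : ℕ, 1 ≤ n ∧ s = 4 * (4:ℝ) ^ (-(n:ℤ)) then π
  else if ∃ n : ℕ, 1 ≤ n ∧ s = 2 * (4:ℝ) ^ (-(n:ℤ)) then 0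
  else if ∃ n : ℕ, 1 ≤ n ∧
      s ∈ Ioo (2 * (4:ℝ) ^ (-(n:ℤ))) (4 * (4:ℝ) ^ (-(n:ℤ)))
  then γ₁ else γ₂

lemma q_tri (k m : ℕ) : k = m ∨ 4 * (4:ℝ) ^ (-(k:ℤ)) ≤ (4:ℝ) ^ (-(m:ℤ)) ∨
    4 * (4:ℝ) ^ (-(m:ℤ)) ≤ (4:ℝ) ^ (-(k:ℤ)) := by
  have key : ∀ a c : ℕ, a < c → 4 * (4:ℝ) ^ (-(c:ℤ)) ≤ (4:ℝ) ^ (-(a:ℤ)) := by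
    intro a c h
    have : 4 * (4:ℝ) ^ (-(c:ℤ)) = (4:ℝ) ^ (1 + -(c:ℤ)) := by
      rw [zpow_add₀ (by norm_num)]; simp
    rw [this]
    exact zpow_le_zpow_right₀ (by norm_num) (by omega)
  rcases lt_trichotomy k m with h | h | h
  · exact Or.inr (Or.inr (key _ _ h))
  · exact Or.inl h
  · exact Or.inr (Or.inl (key _ _ h))

lemma q_pos (k : ℕ) : 0 < (4:ℝ) ^ (-(k:ℤ)) := by positivity

lemma q_succ (k : ℕ) : (4:ℝ) ^ (-(k:ℤ)) = 4 * (4:ℝ) ^ (-((k+1 : ℕ):ℤ)) := by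
  have : (-(k:ℤ)) = 1 + -((k+1 : ℕ):ℤ) := by push_cast; ring
  rw [this, zpow_add₀ (by norm_num)]; simp

lemma g_hi (γ₁ γ₂ : ℝ) (m : ℕ) (hm : 1 ≤ m) (s : ℝ)
    (h : s ∈ Ioo (2 * (4:ℝ) ^ (-(m:ℤ))) (4 * (4:ℝ) ^ (-(m:ℤ)))) : gammaEx2 γ₁ γ₂ s = γ₁ := by
  have h' := h
  obtain ⟨ha, hb⟩ := h
  have hq := q_pos m
  unfold gammaEx2
  rw [if_neg, if_neg, if_pos ⟨m, hm, h'⟩]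
  · rintro ⟨k, -, hk⟩
    rcases q_tri k m with h | h | h
    · subst h; linarith
    · linarith
    · linarith
  · rintro ⟨k, -, hk⟩
    rcases q_tri k m with h | h | h
    · subst h; linarith
    · linarith
    · linarith

lemma g_lo (γ₁ γ₂ : ℝ) (m : ℕ) (s : ℝ)
    (h : s ∈ Ioo ((4:ℝ) ^ (-(m:ℤ))) (2 * (4:ℝ) ^ (-(m:ℤ)))) : gammaEx2 γ₁ γ₂ s = γ₂ := by
  obtain ⟨ha, hb⟩ := h
  have hq := q_pos m
  unfold gammaEx2
  rw [if_neg, if_neg, if_neg]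
  · rintro ⟨k, -, hk1, hk2⟩
    rcases q_tri k m with h | h | h
    · subst h; linarith
    · linarith
    · linarith
  · rintro ⟨k, -, hk⟩
    rcases q_tri k m with h | h | h
    · subst h; linarith
    · linarith
    · linarith
  · rintro ⟨k, -, hk⟩
    rcases q_tri k m with h | h | h
    · subst h; linarith
    · linarith
    · linarith

lemma g_meas (γ₁ γ₂ : ℝ) : Measurable (gammaEx2 γ₁ γ₂) := by
  have hc : ∀ c : ℝ, MeasurableSet {s : ℝ | ∃ n : ℕ, 1 ≤ n ∧ s = c * (4:ℝ) ^ (-(n:ℤ))} := by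
    intro c
    apply Set.Countable.measurableSet
    apply (Set.countable_range (fun n : ℕ => c * (4:ℝ) ^ (-(n:ℤ)))).mono
    rintro s ⟨n, -, rfl⟩
    exact ⟨n, rfl⟩
  unfold gammaEx2
  refine Measurable.ite (hc 4) measurable_const (Measurable.ite (hc 2) measurable_const
    (Measurable.ite ?_ measurable_const measurable_const))
  have : {s : ℝ | ∃ n : ℕ, 1 ≤ n ∧ s ∈ Ioo (2 * (4:ℝ) ^ (-(n:ℤ))) (4 * (4:ℝ) ^ (-(n:ℤ)))} =
      ⋃ n : ℕ, ⋃ _ : 1 ≤ n, Ioo (2 * (4:ℝ) ^ (-(n:ℤ))) (4 * (4:ℝ) ^ (-(n:ℤ))) := by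
    ext s; simp only [Set.mem_setOf_eq, Set.mem_iUnion, exists_prop]
  rw [this]
  exact MeasurableSet.iUnion fun n => MeasurableSet.iUnion fun _ => measurableSet_Ioo

lemma f_int (γ₁ γ₂ u v : ℝ) :
    IntervalIntegrable (fun t => Real.cos (gammaEx2 γ₁ γ₂ t)) volume u v := by
  refine (intervalIntegrable_const (c := (1:ℝ))).mono_fun
    ((Real.measurable_cos.comp (g_meas γ₁ γ₂)).aestronglyMeasurable) ?_
  filter_upwards with t
  simpa using Real.abs_cos_le_one _

lemma f_const (γ₁ γ₂ u v c : ℝ) (huv : u ≤ v) (h : ∀ s ∈ Ioo u v, gammaEx2 γ₁ γ₂ s = c) :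
    ∫ t in u..v, Real.cos (gammaEx2 γ₁ γ₂ t) = (v - u) * Real.cos c := by
  rw [intervalIntegral.integral_of_le huv, integral_Ioc_eq_integral_Ioo,
    setIntegral_congr_fun measurableSet_Ioo (g := fun _ => Real.cos c)
      (fun s hs => by simp only [h s hs])]
  simp [huv]

lemma F_add (γ₁ γ₂ u v : ℝ) : ∫ t in (0:ℝ)..v, Real.cos (gammaEx2 γ₁ γ₂ t) =
    (∫ t in (0:ℝ)..u, Real.cos (gammaEx2 γ₁ γ₂ t)) + ∫ t in u..v, Real.cos (gammaEx2 γ₁ γ₂ t) :=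
  (intervalIntegral.integral_add_adjacent_intervals (f_int ..) (f_int ..)).symm

lemma F_q (γ₁ γ₂ : ℝ) (n : ℕ) :
    ∫ t in (0:ℝ)..(4:ℝ) ^ (-(n:ℤ)), Real.cos (gammaEx2 γ₁ γ₂ t) =
      (4:ℝ) ^ (-(n:ℤ)) * ((2/3) * Real.cos γ₁ + (1/3) * Real.cos γ₂) := by
  set M := (2/3) * Real.cos γ₁ + (1/3) * Real.cos γ₂ with hM
  set F : ℝ → ℝ := fun x => ∫ t in (0:ℝ)..x, Real.cos (gammaEx2 γ₁ γ₂ t) with hF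
  set D : ℕ → ℝ := fun n => F ((4:ℝ) ^ (-(n:ℤ))) - (4:ℝ) ^ (-(n:ℤ)) * M with hD
  have step : ∀ n, D n = D (n+1) := by
    intro n
    have e := q_succ n
    simp only [hD]
    rw [e]
    set q := (4:ℝ) ^ (-((n+1:ℕ):ℤ)) with hq
    have hq0 : 0 < q := q_pos _
    have a1 : F (4*q) = F (2*q) + (4*q-2*q) * Real.cos γ₁ := by
      rw [← f_const γ₁ γ₂ (2*q) (4*q) γ₁ (by linarith) (fun s hs => g_hi γ₁ γ₂ (n+1) (by omega) s hs)]
      exact F_add ..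
    have a2 : F (2*q) = F q + (2*q-q) * Real.cos γ₂ := by
      rw [← f_const γ₁ γ₂ q (2*q) γ₂ (by linarith) (fun s hs => g_lo γ₁ γ₂ (n+1) s hs)]
      exact F_add ..
    rw [a1, a2, hM]; ring
  have hall : ∀ k, D (n + k) = D n := by
    intro k
    induction k with
    | zero => rfl
    | succ k ih => rw [← ih, ← add_assoc, ← step]
  have hq0 : Tendsto (fun k : ℕ => (4:ℝ) ^ (-(k:ℤ))) atTop (𝓝 0) := by
    have := tendsto_pow_atTop_nhds_zero_of_lt_one (r := (1/4:ℝ)) (by norm_num) (by norm_num)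
    refine this.congr fun k => ?_
    simp
  have hc : Continuous F := intervalIntegral.continuous_primitive (fun u v => f_int γ₁ γ₂ u v) 0
  have hD0 : Tendsto D atTop (𝓝 0) := by
    have h1 := (hc.tendsto 0).comp hq0
    have h2 := h1.sub (hq0.mul_const M)
    simpa [hF, hD] using h2
  have h3 : Tendsto (fun k => D (n + k)) atTop (𝓝 0) := by
    simpa [add_comm] using (tendsto_add_atTop_iff_nat n).2 hD0
  simp only [hall] at h3
  have := tendsto_nhds_unique h3 tendsto_const_nhds
  simp only [hD] at this
  linarith

lemma F_le (γ₁ γ₂ : ℝ) (hcos : Real.cos γ₂ ≤ Real.cos γ₁) (x : ℝ) (hx : 0 < x) (hx1 : x < 1) :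
    ∫ t in (0:ℝ)..x, Real.cos (gammaEx2 γ₁ γ₂ t) ≤
      x * ((2/3) * Real.cos γ₁ + (1/3) * Real.cos γ₂) := by
  obtain ⟨n, hn1, hn2⟩ := exists_nat_pow_near_of_lt_one (y := (1/4:ℝ)) hx hx1.le (by norm_num) (by norm_num)
  have hpow : ∀ k : ℕ, (1/4:ℝ)^k = (4:ℝ) ^ (-(k:ℤ)) := by intro k; simp
  rw [hpow] at hn1 hn2
  have e := q_succ n
  have f1 := F_q γ₁ γ₂ n
  have f2 := F_q γ₁ γ₂ (n+1)
  rw [e] at hn2 f1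
  set q := (4:ℝ) ^ (-((n+1:ℕ):ℤ)) with hq
  have hq0 : 0 < q := q_pos _
  rcases le_total x (2*q) with h | h
  · rw [F_add γ₁ γ₂ q x, f2, f_const γ₁ γ₂ q x γ₂ hn1.le
      (fun s hs => g_lo γ₁ γ₂ (n+1) s ⟨hs.1, hs.2.trans_le h⟩)]
    nlinarith
  · rw [F_add γ₁ γ₂ x (4*q), f_const γ₁ γ₂ x (4*q) γ₁ hn2
      (fun s hs => g_hi γ₁ γ₂ (n+1) (by omega) s ⟨h.trans_lt hs.1, hs.2⟩)] at f1
    nlinarith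

/-- For the contact angle of Example 2 and any `b ∈ (0,1)`,
`limsup_{ε→0⁺} (1/ε) ∫₀^{bε} cos(γ(t)) dt = b·((2/3)cos γ₁ + (1/3)cos γ₂)`. -/
theorem example2_limsup (γ₁ γ₂ : ℝ) (h₁ : 0 ≤ γ₁) (h₁₂ : γ₁ ≤ γ₂) (h₂ : γ₂ ≤ π)
    (b : ℝ) (hb : b ∈ Ioo (0:ℝ) 1) :
    limsup (fun ε : ℝ => ε⁻¹ * ∫ t in Ioo (0:ℝ) (b * ε), Real.cos (gammaEx2 γ₁ γ₂ t))
        (𝓝[>] (0:ℝ)) =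
      b * ((2/3) * Real.cos γ₁ + (1/3) * Real.cos γ₂) := by
  obtain ⟨hb0, hb1⟩ := hb
  have hcos : Real.cos γ₂ ≤ Real.cos γ₁ := Real.cos_le_cos_of_nonneg_of_le_pi h₁ h₂ h₁₂
  have conv : ∀ x : ℝ, 0 < x → ∫ t in Ioo (0:ℝ) x, Real.cos (gammaEx2 γ₁ γ₂ t) =
      ∫ t in (0:ℝ)..x, Real.cos (gammaEx2 γ₁ γ₂ t) := by
    intro x hx
    rw [intervalIntegral.integral_of_le hx.le, integral_Ioc_eq_integral_Ioo]
  have hup : ∀ᶠ ε in 𝓝[>] (0:ℝ),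
      ε⁻¹ * ∫ t in Ioo (0:ℝ) (b * ε), Real.cos (gammaEx2 γ₁ γ₂ t) ≤
        b * ((2/3) * Real.cos γ₁ + (1/3) * Real.cos γ₂) := by
    filter_upwards [Ioo_mem_nhdsGT (show (0:ℝ) < 1 by norm_num)] with ε hε
    obtain ⟨he0, he1⟩ := hε
    have hp : 0 < b * ε := mul_pos hb0 he0
    rw [conv _ hp, inv_mul_le_iff₀ he0]
    have := F_le γ₁ γ₂ hcos (b * ε) hp (by nlinarith)
    linarith
  have hfr : ∃ᶠ ε in 𝓝[>] (0:ℝ), b * ((2/3) * Real.cos γ₁ + (1/3) * Real.cos γ₂) ≤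
      ε⁻¹ * ∫ t in Ioo (0:ℝ) (b * ε), Real.cos (gammaEx2 γ₁ γ₂ t) := by
    have ht : Tendsto (fun k : ℕ => (4:ℝ) ^ (-(k:ℤ)) / b) atTop (𝓝[>] (0:ℝ)) := by
      rw [tendsto_nhdsWithin_iff]
      constructor
      · have := tendsto_pow_atTop_nhds_zero_of_lt_one (r := (1/4:ℝ)) (by norm_num) (by norm_num)
        have := this.div_const b
        simpa using this
      · exact Eventually.of_forall fun k => div_pos (q_pos k) hb0
    refine ht.frequently (Eventually.of_forall fun k => ?_).frequently
    have hq := q_pos k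
    have : b * ((4:ℝ) ^ (-(k:ℤ)) / b) = (4:ℝ) ^ (-(k:ℤ)) := by field_simp
    rw [this, conv _ hq, F_q]
    apply le_of_eq
    field_simp
  apply le_antisymm
  · exact limsup_le_of_le (IsCoboundedUnder.of_frequently_ge hfr) hup
  · exact le_limsup_of_frequently_le hfr (isBoundedUnder_of_eventually_le hup)
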